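/- For an integer n, let V_n = {f ∈ k((S)) : the coefficient of Sⁿ in f is 0}, a closed k-subspace of k((S)) stable under d − n·id. Then the restriction of d − n·id to V_n is a bijective isometry of V_n onto itself; in particular it is invertible in L_k(V_n) and its inverse has operator norm 1. -/

import Mathlib

noncomputable section
open scoped Classical

/-- The operator `d = S·d/dS` on `k((S))`. -/
def dOp {k : Type*} [Field k] (f : LaurentSeries k) : LaurentSeries k :=
  ⟨fun i => (i : k) * f.coeff i,
    f.isPWO_support'.mono fun i hi => by
      simp only [Function.mem_support, ne_eq] at hi ⊢
      intro h
      exact hi (by rw [h, mul_zero])⟩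

/-- The `S`-adic absolute value on `k((S))` with `|S| = r` (and `k` trivially valued). -/
def lnorm {k : Type*} [Field k] (r : ℝ) (f : LaurentSeries k) : ℝ :=
  if f = 0 then 0 else r ^ f.order

theorem coeff_dOp_sub_smul {k : Type*} [Field k] (n : ℤ) (f : LaurentSeries k) (i : ℤ) :
    (dOp f - (n : k) • f).coeff i = ((i : k) - n) * f.coeff i := by
  rw [HahnSeries.coeff_sub, HahnSeries.coeff_smul, smul_eq_mul, sub_mul]
  rfl

/-- The absolute value of a Laurent series depends only on its support. -/
theorem lnorm_congr {k : Type*} [Field k] (r : ℝ) {f g : LaurentSeries k}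
    (h : ∀ i, f.coeff i = 0 ↔ g.coeff i = 0) : lnorm r f = lnorm r g := by
  have h0 : f = 0 ↔ g = 0 := by
    simp only [HahnSeries.ext_iff, funext_iff, HahnSeries.coeff_zero, h]
  by_cases hf : f = 0
  · simp only [lnorm, if_pos hf, if_pos (h0.1 hf)]
  · have hg : g ≠ 0 := fun hg => hf (h0.2 hg)
    have ho : f.order = g.order := le_antisymm
      (HahnSeries.order_le_of_coeff_ne_zero fun e =>
        HahnSeries.coeff_order_eq_zero.not.2 hg ((h _).1 e))
      (HahnSeries.order_le_of_coeff_ne_zero fun e =>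
        HahnSeries.coeff_order_eq_zero.not.2 hf ((h _).2 e))
    simp only [lnorm, if_neg hf, if_neg hg, ho]

theorem lnorm_pos {k : Type*} [Field k] {r : ℝ} (hr0 : 0 < r) {f : LaurentSeries k}
    (hf : f ≠ 0) : 0 < lnorm r f := by
  rw [lnorm, if_neg hf]
  exact zpow_pos hr0 _

theorem zpow_le_lnorm {k : Type*} [Field k] {r : ℝ} (hr0 : 0 < r) (hr1 : r < 1)
    {f : LaurentSeries k} {n : ℤ} (hf : f.coeff n ≠ 0) : r ^ n ≤ lnorm r f := by
  have h0 : f ≠ 0 := by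
    rintro rfl
    exact hf rfl
  rw [lnorm, if_neg h0]
  exact zpow_le_zpow_right_of_le_one₀ hr0 hr1.le (HahnSeries.order_le_of_coeff_ne_zero hf)

/-- The inverse of `d − n·id` on `Vₙ`: divide the coefficient of `Sⁱ` by `i − n`
(and by convention send the coefficient of `Sⁿ` to `0`). -/
def dOpSubInv {k : Type*} [Field k] (n : ℤ) (f : LaurentSeries k) : LaurentSeries k :=
  ⟨fun i => ((i : k) - n)⁻¹ * f.coeff i,
    f.isPWO_support'.mono fun i hi => by
      simp only [Function.mem_support, ne_eq] at hi ⊢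
      intro h
      exact hi (by rw [h, mul_zero])⟩

theorem coeff_dOpSubInv {k : Type*} [Field k] (n : ℤ) (f : LaurentSeries k) (i : ℤ) :
    (dOpSubInv n f).coeff i = ((i : k) - n)⁻¹ * f.coeff i := rfl

theorem intCast_sub_ne_zero {k : Type*} [Field k] [CharZero k] {i n : ℤ} (h : i ≠ n) :
    (i : k) - n ≠ 0 := sub_ne_zero.2 (Int.cast_injective.ne h)

theorem dOpSubInv_dOp_sub {k : Type*} [Field k] [CharZero k] {n : ℤ} {f : LaurentSeries k}
    (hf : f.coeff n = 0) : dOpSubInv n (dOp f - (n : k) • f) = f := by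
  ext i
  rw [coeff_dOpSubInv, coeff_dOp_sub_smul]
  obtain rfl | h := eq_or_ne i n
  · simp [hf]
  · exact inv_mul_cancel_left₀ (intCast_sub_ne_zero h) _

theorem dOp_sub_dOpSubInv {k : Type*} [Field k] [CharZero k] {n : ℤ} {g : LaurentSeries k}
    (hg : g.coeff n = 0) : dOp (dOpSubInv n g) - (n : k) • dOpSubInv n g = g := by
  ext i
  rw [coeff_dOp_sub_smul, coeff_dOpSubInv]
  obtain rfl | h := eq_or_ne i n
  · simp [hg]
  · exact mul_inv_cancel_left₀ (intCast_sub_ne_zero h) _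

theorem coeff_dOpSubInv_self {k : Type*} [Field k] (n : ℤ) (g : LaurentSeries k) :
    (dOpSubInv n g).coeff n = 0 := by
  simp [coeff_dOpSubInv]

theorem lnorm_dOp_sub {k : Type*} [Field k] [CharZero k] (r : ℝ) {n : ℤ}
    {f : LaurentSeries k} (hf : f.coeff n = 0) :
    lnorm r (dOp f - (n : k) • f) = lnorm r f := by
  refine lnorm_congr r fun i => ?_
  rw [coeff_dOp_sub_smul]
  obtain rfl | h := eq_or_ne i n
  · simp [hf]
  · simp [intCast_sub_ne_zero h]

theorem lnorm_dOpSubInv {k : Type*} [Field k] [CharZero k] (r : ℝ) {n : ℤ}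
    {g : LaurentSeries k} (hg : g.coeff n = 0) : lnorm r (dOpSubInv n g) = lnorm r g := by
  rw [← lnorm_dOp_sub r (coeff_dOpSubInv_self n g), dOp_sub_dOpSubInv hg]

/-- for an integer `n`, the subspace `Vₙ = {f : coefficient of Sⁿ in f is 0}`
of `k((S))` is closed (for the `S`-adic metric) and stable under `d − n·id`, and the
restriction of `d − n·id` to `Vₙ` is a bijective isometry of `Vₙ` onto itself; in
particular it is invertible in `L_k(Vₙ)` and its inverse has operator norm `1`. -/
theorem dOp_sub_n_bijective_isometry_on_Vn
    {k : Type*} [Field k] [CharZero k] (r : ℝ) (hr0 : 0 < r) (hr1 : r < 1) (n : ℤ) :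
    -- `Vₙ` is a `k`-subspace ...
    (∀ f g : LaurentSeries k, f.coeff n = 0 → g.coeff n = 0 → (f + g).coeff n = 0) ∧
    (∀ (c : k) (f : LaurentSeries k), f.coeff n = 0 → (c • f).coeff n = 0) ∧
    -- ... which is closed for the `S`-adic metric ...
    (∀ f : LaurentSeries k,
      (∀ ε : ℝ, 0 < ε → ∃ g : LaurentSeries k, g.coeff n = 0 ∧ lnorm r (f - g) < ε) →
      f.coeff n = 0) ∧
    -- ... and stable under `d − n·id`;
    (∀ f : LaurentSeries k, f.coeff n = 0 → (dOp f - (n : k) • f).coeff n = 0) ∧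
    -- the restriction of `d − n·id` to `Vₙ` is a bijection of `Vₙ` onto itself ...
    (∀ g : LaurentSeries k, g.coeff n = 0 →
      ∃! f : LaurentSeries k, f.coeff n = 0 ∧ dOp f - (n : k) • f = g) ∧
    -- ... which is an isometry;
    (∀ f : LaurentSeries k, f.coeff n = 0 →
      lnorm r (dOp f - (n : k) • f) = lnorm r f) ∧
    -- in particular it is invertible in `L_k(Vₙ)`, with (linear bounded) inverse `ψ`
    -- of operator norm `1`.
    (∃ ψ : LaurentSeries k → LaurentSeries k,
      (∀ g, g.coeff n = 0 → (ψ g).coeff n = 0) ∧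
      (∀ f g : LaurentSeries k, f.coeff n = 0 → g.coeff n = 0 → ψ (f + g) = ψ f + ψ g) ∧
      (∀ (c : k) (f : LaurentSeries k), f.coeff n = 0 → ψ (c • f) = c • ψ f) ∧
      (∀ f, f.coeff n = 0 → ψ (dOp f - (n : k) • f) = f) ∧
      (∀ g, g.coeff n = 0 → dOp (ψ g) - (n : k) • ψ g = g) ∧
      sSup {x : ℝ | ∃ g : LaurentSeries k, g.coeff n = 0 ∧ g ≠ 0 ∧
        x = lnorm r (ψ g) / lnorm r g} = 1) := by
  refine ⟨fun f g hf hg => by rw [HahnSeries.coeff_add, hf, hg, add_zero],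
    fun c f hf => by rw [HahnSeries.coeff_smul, hf, smul_zero], fun f hf => ?_,
    fun f _ => by rw [coeff_dOp_sub_smul, sub_self, zero_mul],
    fun g hg => ⟨dOpSubInv n g, ⟨coeff_dOpSubInv_self n g, dOp_sub_dOpSubInv hg⟩, ?_⟩,
    fun f hf => lnorm_dOp_sub r hf,
    dOpSubInv n, fun g _ => coeff_dOpSubInv_self n g, fun f g _ _ => ?_, fun c f _ => ?_,
    fun f hf => dOpSubInv_dOp_sub hf, fun g hg => dOp_sub_dOpSubInv hg, ?_⟩
  · obtain ⟨g, hg, hlt⟩ := hf (r ^ n) (zpow_pos hr0 n)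
    by_contra h
    refine absurd (zpow_le_lnorm hr0 hr1 (f := f - g) (n := n) ?_) hlt.not_ge
    rwa [HahnSeries.coeff_sub, hg, sub_zero]
  · rintro f ⟨hf, rfl⟩
    exact (dOpSubInv_dOp_sub hf).symm
  · ext i
    simp only [coeff_dOpSubInv, HahnSeries.coeff_add, mul_add]
  · ext i
    simp only [coeff_dOpSubInv, HahnSeries.coeff_smul, smul_eq_mul, mul_left_comm]
  · refine Eq.trans (congrArg sSup (Set.ext fun x => ?_)) (csSup_singleton (1 : ℝ))
    rw [Set.mem_singleton_iff]
    constructor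
    · rintro ⟨g, hg, hg0, rfl⟩
      rw [lnorm_dOpSubInv r hg, div_self (lnorm_pos hr0 hg0).ne']
    · rintro rfl
      have hg : (HahnSeries.single (n + 1) (1 : k) : LaurentSeries k).coeff n = 0 :=
        HahnSeries.coeff_single_of_ne (by omega)
      have hg0 : (HahnSeries.single (n + 1) (1 : k) : LaurentSeries k) ≠ 0 :=
        HahnSeries.single_ne_zero one_ne_zero
      refine ⟨_, hg, hg0, ?_⟩
      rw [lnorm_dOpSubInv r hg, div_self (lnorm_pos hr0 hg0).ne']
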